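/- Let 𝒳 be a finite set, k ≥ 1, p : 𝒳 → ℝ a probability mass function with p(x) > 0 for all x, and d : 𝒳^k → ℝ with d(X) > 0 for all tuples X ∈ 𝒳^k. For tuples X, X' ∈ 𝒳^k that differ in exactly one coordinate i, define the transition kernel T(X'|X) = (1/2) · (1/k) · p(x'_i) · d(X') / (d(X) + d(X')). Then for all such pairs X, X' the detailed balance equation Q(X)·T(X'|X) = Q(X')·T(X|X') holds with respect to Q(X) = (∏_{b=1}^k p(x_b)) · d(X). -/

import Mathlib

/-- Detailed balance for the modified Gibbs sampler (adapted from Li et al. 2016):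
for batches `X, X' ∈ 𝒳^k` differing in exactly one coordinate `i`, the transition
kernel is `T(X'|X) = (1/2) * (1/k) * p(x'_i) * d(X') / (d(X) + d(X'))`, and detailed
balance holds with respect to `Q(X) = (∏_b p(x_b)) * d(X)`. Here `T X X'` denotes
`T(X'|X)`. -/
theorem modified_gibbs_detailed_balance (𝒳 : Type*) [Fintype 𝒳] (k : ℕ) (hk : 1 ≤ k)
    (p : 𝒳 → ℝ) (hp : ∀ x, 0 < p x) (hpsum : ∑ x, p x = 1)
    (d : (Fin k → 𝒳) → ℝ) (hd : ∀ X, 0 < d X)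
    (T : (Fin k → 𝒳) → (Fin k → 𝒳) → ℝ)
    (hT : ∀ (X X' : Fin k → 𝒳) (i : Fin k), X i ≠ X' i → (∀ j ≠ i, X j = X' j) →
      T X X' = (1 / 2) * (1 / (k : ℝ)) * p (X' i) * d X' / (d X + d X'))
    (X X' : Fin k → 𝒳) (i : Fin k) (hi : X i ≠ X' i) (hj : ∀ j ≠ i, X j = X' j) :
    ((∏ b, p (X b)) * d X) * T X X' = ((∏ b, p (X' b)) * d X') * T X' X := by
  have hrest : ∏ b ∈ Finset.univ.erase i, p (X b) = ∏ b ∈ Finset.univ.erase i, p (X' b) :=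
    Finset.prod_congr rfl fun j hji => by rw [hj j (Finset.ne_of_mem_erase hji)]
  rw [hT X X' i hi hj, hT X' X i hi.symm fun j hji => (hj j hji).symm,
    ← Finset.mul_prod_erase Finset.univ (fun b => p (X b)) (Finset.mem_univ i),
    ← Finset.mul_prod_erase Finset.univ (fun b => p (X' b)) (Finset.mem_univ i),
    hrest, add_comm (d X') (d X)]
  ring
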